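/- Let u, λ, t_p, t_q ∈ ℂ and assume that ϑ₁(u−t_p), ϑ₁(u−t_q), ϑ₁(u−λ−t_q), ϑ₁(λ), ϑ₁(−λ), ϑ₁(λ−t_p+t_q), ϑ₁(t_p−t_q−λ) and ϑ₁(t_p−t_q) are all nonzero. Then (ϑ₁(u−t_p)/ϑ₁(u−t_q))·(d/du) 𝔰(u−t_p; λ−t_p+t_q) = (ϑ₁(λ)/ϑ₁(λ−t_p+t_q))·(ρ(t_p−t_q) − ρ(λ))·𝔰(u−t_q;λ) − (ϑ₁′(0)/ϑ₁(t_p−t_q))·𝔰(u−t_p;λ), where (d/du) 𝔰(u−t_p; λ−t_p+t_q) denotes the derivative at u of the function w ↦ 𝔰(w−t_p; λ−t_p+t_q). -/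

import Mathlib

open Complex Filter

/-- The theta function ϑ₁(u,τ). -/
noncomputable def theta (τ u : ℂ) : ℂ :=
  -∑' m : ℤ, Complex.exp ((Real.pi : ℂ) * Complex.I * (m + 1/2)^2 * τ +
    2 * (Real.pi : ℂ) * Complex.I * (m + 1/2) * (u + 1/2))

/-- Derivative ϑ₁′ in u. -/
noncomputable def theta' (τ : ℂ) : ℂ → ℂ := deriv (theta τ)

/-- ρ(u) = ϑ₁′(u)/ϑ₁(u). -/
noncomputable def rho (τ u : ℂ) : ℂ := theta' τ u / theta τ u

/-- 𝔰(u;λ) = ϑ₁(u−λ)ϑ₁′(0)/(ϑ₁(u)ϑ₁(−λ)). -/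
noncomputable def fraks (τ u lam : ℂ) : ℂ :=
  theta τ (u - lam) * theta' τ 0 / (theta τ u * theta τ (-lam))

/-- The subseries of `∑ p, exp (πi p² τ / 2 + 2πi p x)` over even `p`. -/
noncomputable def evenTheta (τ x : ℂ) : ℂ := jacobiTheta₂ (2 * x) (2 * τ)

/-- The subseries of `∑ p, exp (πi p² τ / 2 + 2πi p x)` over odd `p`. -/
noncomputable def oddTheta (τ x : ℂ) : ℂ :=
  Complex.exp (Real.pi * Complex.I * (τ / 2 + 2 * x)) * jacobiTheta₂ (2 * x + τ) (2 * τ)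

lemma two_mul_im_pos {τ : ℂ} (hτ : 0 < τ.im) : 0 < (2 * τ).im := by
  simpa using hτ

lemma hasSum_evenTheta {τ : ℂ} (hτ : 0 < τ.im) (x : ℂ) :
    HasSum (fun k : ℤ => Complex.exp (Real.pi * Complex.I * (2 * k ^ 2 * τ + 4 * k * x)))
      (evenTheta τ x) := by
  unfold evenTheta
  convert! hasSum_jacobiTheta₂_term (2 * x) (two_mul_im_pos hτ) using 2 with k
  rw [jacobiTheta₂_term]
  ring_nf

lemma hasSum_oddTheta {τ : ℂ} (hτ : 0 < τ.im) (x : ℂ) :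
    HasSum (fun k : ℤ => Complex.exp (Real.pi * Complex.I *
      ((2 * k + 1) ^ 2 / 2 * τ + 2 * (2 * k + 1) * x))) (oddTheta τ x) := by
  unfold oddTheta
  convert! (hasSum_jacobiTheta₂_term (2 * x + τ) (two_mul_im_pos hτ)).mul_left
    (Complex.exp (Real.pi * Complex.I * (τ / 2 + 2 * x))) using 2 with k
  rw [jacobiTheta₂_term, ← Complex.exp_add]
  ring_nf

lemma theta_eq_jacobiTheta₂ (τ u : ℂ) :
    theta τ u = -(Complex.exp (Real.pi * Complex.I * (τ / 4 + u + 1 / 2)) *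
      jacobiTheta₂ (u + 1 / 2 + τ / 2) τ) := by
  rw [theta, jacobiTheta₂, ← tsum_mul_left]
  congr 2 with m
  rw [jacobiTheta₂_term, ← Complex.exp_add]
  ring_nf

lemma hasSum_neg_theta {τ : ℂ} (hτ : 0 < τ.im) (u : ℂ) :
    HasSum (fun m : ℤ => Complex.exp ((Real.pi : ℂ) * Complex.I * (m + 1/2)^2 * τ +
      2 * (Real.pi : ℂ) * Complex.I * (m + 1/2) * (u + 1/2))) (-theta τ u) := by
  rw [theta_eq_jacobiTheta₂, neg_neg]
  convert! (hasSum_jacobiTheta₂_term (u + 1 / 2 + τ / 2) hτ).mul_left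
    (Complex.exp (Real.pi * Complex.I * (τ / 4 + u + 1 / 2))) using 2 with m
  rw [jacobiTheta₂_term, ← Complex.exp_add]
  ring_nf

lemma differentiable_jacobiTheta₂_fst {τ : ℂ} (hτ : 0 < τ.im) :
    Differentiable ℂ (fun z => jacobiTheta₂ z τ) :=
  fun z => differentiableAt_jacobiTheta₂_fst z hτ

lemma differentiable_theta {τ : ℂ} (hτ : 0 < τ.im) : Differentiable ℂ (theta τ) := by
  rw [funext (theta_eq_jacobiTheta₂ τ)]
  have := (differentiable_jacobiTheta₂_fst hτ).comp
    (by fun_prop : Differentiable ℂ fun u : ℂ => u + 1 / 2 + τ / 2)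
  simp only [Function.comp_def] at this
  fun_prop

lemma differentiable_evenTheta {τ : ℂ} (hτ : 0 < τ.im) : Differentiable ℂ (evenTheta τ) :=
  (differentiable_jacobiTheta₂_fst (two_mul_im_pos hτ)).comp
    (by fun_prop : Differentiable ℂ fun x : ℂ => 2 * x)

lemma differentiable_oddTheta {τ : ℂ} (hτ : 0 < τ.im) : Differentiable ℂ (oddTheta τ) := by
  have := (differentiable_jacobiTheta₂_fst (two_mul_im_pos hτ)).comp
    (by fun_prop : Differentiable ℂ fun x : ℂ => 2 * x + τ)
  simp only [Function.comp_def] at this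
  unfold oddTheta
  fun_prop

lemma HasSum.mul_prod_complex {ι κ : Type*} {f : ι → ℂ} {g : κ → ℂ} {a b : ℂ}
    (hf : HasSum f a) (hg : HasSum g b) :
    HasSum (fun p : ι × κ => f p.1 * g p.2) (a * b) :=
  hf.mul hg (summable_mul_of_summable_norm hf.summable.norm hg.summable.norm)

/-- The change of variables `(m, n) ↦ (m + n + 1, m - n)` splits `ℤ × ℤ` into the pairs
`(2k, 2l + 1)` (left) and the pairs `(2k + 1, 2l)` (right). -/
def intPairParityEquiv : (ℤ × ℤ) ⊕ (ℤ × ℤ) ≃ ℤ × ℤ where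
  toFun := Sum.elim (fun p => (p.1 + p.2, p.1 - p.2 - 1)) (fun p => (p.1 + p.2, p.1 - p.2))
  invFun p :=
    if (p.1 + p.2) % 2 = 0 then Sum.inr ((p.1 + p.2) / 2, (p.1 - p.2) / 2)
    else Sum.inl ((p.1 + p.2 + 1) / 2, (p.1 - p.2 - 1) / 2)
  left_inv := by
    rintro (⟨k, l⟩ | ⟨k, l⟩)
    · have h : ¬ (k + l + (k - l - 1)) % 2 = 0 := by lia
      simp only [Sum.elim_inl, h, if_false, Sum.inl.injEq, Prod.mk.injEq]
      lia
    · have h : (k + l + (k - l)) % 2 = 0 := by lia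
      simp only [Sum.elim_inr, h, if_true, Sum.inr.injEq, Prod.mk.injEq]
      lia
  right_inv := by
    rintro ⟨m, n⟩
    by_cases h : (m + n) % 2 = 0
    · simp only [h, if_true, Sum.elim_inr, Prod.mk.injEq]
      lia
    · simp only [h, if_false, Sum.elim_inl, Prod.mk.injEq]
      lia

/-- The product formula for `ϑ₁`, expressing `ϑ₁(x+y)ϑ₁(x-y)` as a `2 × 2` determinant. -/
lemma theta_add_mul_theta_sub {τ : ℂ} (hτ : 0 < τ.im) (x y : ℂ) :
    theta τ (x + y) * theta τ (x - y) =
      evenTheta τ x * oddTheta τ y - oddTheta τ x * evenTheta τ y := by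
  have hL := (hasSum_neg_theta hτ (x + y)).mul_prod_complex (hasSum_neg_theta hτ (x - y))
  rw [neg_mul_neg, ← intPairParityEquiv.hasSum_iff] at hL
  refine hL.unique ?_
  rw [sub_eq_add_neg (evenTheta τ x * _)]
  apply HasSum.sum
  · convert! (hasSum_evenTheta hτ x).mul_prod_complex (hasSum_oddTheta hτ y) using 2 with p
    obtain ⟨k, l⟩ := p
    simp only [Function.comp_apply, intPairParityEquiv, Equiv.coe_fn_mk, Sum.elim_inl,
      ← Complex.exp_add]
    rw [Complex.exp_eq_exp_iff_exists_int]
    refine ⟨k, ?_⟩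
    push_cast
    ring
  · convert! ((hasSum_oddTheta hτ x).mul_prod_complex (hasSum_evenTheta hτ y)).neg using 2 with p
    obtain ⟨k, l⟩ := p
    simp only [Function.comp_apply, intPairParityEquiv, Equiv.coe_fn_mk, Sum.elim_inr,
      ← Complex.exp_add]
    rw [← neg_one_mul, ← Complex.exp_pi_mul_I, ← Complex.exp_add,
      Complex.exp_eq_exp_iff_exists_int]
    refine ⟨k, ?_⟩
    push_cast
    ring

lemma theta_zero {τ : ℂ} (hτ : 0 < τ.im) : theta τ 0 = 0 := by
  have h := theta_add_mul_theta_sub hτ 0 0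
  rw [add_zero, sub_zero, mul_comm (oddTheta τ 0), sub_self] at h
  exact mul_self_eq_zero.mp h

lemma theta_neg {τ : ℂ} (hτ : 0 < τ.im) (v : ℂ) : theta τ (-v) = -theta τ v := by
  have key (s : ℂ) : theta τ s * (theta τ v + theta τ (-v)) = 0 := by
    have h₁ := theta_add_mul_theta_sub hτ ((s + v) / 2) ((s - v) / 2)
    have h₂ := theta_add_mul_theta_sub hτ ((s - v) / 2) ((s + v) / 2)
    ring_nf at h₁ h₂ ⊢
    linear_combination h₁ + h₂
  have h : (theta τ v + theta τ (-v)) ^ 2 = 0 := by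
    linear_combination key v + key (-v)
  linear_combination pow_eq_zero_iff two_ne_zero |>.mp h

lemma hasDerivAt_theta {τ : ℂ} (hτ : 0 < τ.im) (u : ℂ) :
    HasDerivAt (theta τ) (theta' τ u) u :=
  (differentiable_theta hτ u).hasDerivAt

lemma theta_add_mul_theta_sub_deriv {τ : ℂ} (hτ : 0 < τ.im) (x w : ℂ) :
    theta' τ (x + w) * theta τ (x - w) - theta τ (x + w) * theta' τ (x - w) =
      evenTheta τ x * deriv (oddTheta τ) w - oddTheta τ x * deriv (evenTheta τ) w := by
  have hL := ((hasDerivAt_theta hτ (x + w)).comp_const_add x w).mul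
    ((hasDerivAt_theta hτ (x - w)).comp_const_sub x w)
  have hR := ((differentiable_oddTheta hτ w).hasDerivAt.const_mul (evenTheta τ x)).sub
    ((differentiable_evenTheta hτ w).hasDerivAt.const_mul (oddTheta τ x))
  rw [sub_eq_add_neg, ← mul_neg]
  refine hL.unique ?_
  convert hR using 1
  ext y
  exact theta_add_mul_theta_sub hτ x y

/-- The degenerate three-term relation, in a form cleared of denominators. -/
lemma theta_three_term_deriv {τ : ℂ} (hτ : 0 < τ.im) (x y w : ℂ) :
    (theta' τ (x + w) * theta τ (x - w) - theta τ (x + w) * theta' τ (x - w)) *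
        (theta τ (y + w) * theta τ (y - w)) -
      theta τ (x + w) * theta τ (x - w) *
        (theta' τ (y + w) * theta τ (y - w) - theta τ (y + w) * theta' τ (y - w)) =
      theta τ (x + y) * theta τ (x - y) * (theta τ (w + w) * theta' τ 0) := by
  have hW := theta_add_mul_theta_sub_deriv hτ w w
  rw [sub_self, theta_zero hτ, mul_zero, zero_sub] at hW
  rw [theta_add_mul_theta_sub_deriv hτ x w, theta_add_mul_theta_sub_deriv hτ y w,
    theta_add_mul_theta_sub hτ x w, theta_add_mul_theta_sub hτ y w,
    theta_add_mul_theta_sub hτ x y]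
  linear_combination (evenTheta τ x * oddTheta τ y - oddTheta τ x * evenTheta τ y) * hW

lemma deriv_fraks_sub_const {τ : ℂ} (hτ : 0 < τ.im) {u t lam : ℂ} (hu : theta τ (u - t) ≠ 0)
    (hlam : theta τ (-lam) ≠ 0) :
    deriv (fun w => fraks τ (w - t) lam) u =
      (theta' τ (u - t - lam) * theta τ (u - t) - theta τ (u - t - lam) * theta' τ (u - t)) *
        theta' τ 0 / (theta τ (u - t) ^ 2 * theta τ (-lam)) := by
  have hN := (hasDerivAt_theta hτ (u - t - lam)).comp_sub_const (u - t) lam |>.comp_sub_const u t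
  have hD := (hasDerivAt_theta hτ (u - t)).comp_sub_const u t
  have h := (hN.mul_const (theta' τ 0)).div (hD.mul_const (theta τ (-lam))) (mul_ne_zero hu hlam)
  refine h.deriv.trans ?_
  field_simp

theorem contiguity_basis_three (τ : ℂ) (hτ : 0 < τ.im) (u lam tp tq : ℂ)
    (h1 : theta τ (u - tp) ≠ 0) (h2 : theta τ (u - tq) ≠ 0)
    (h3 : theta τ (u - lam - tq) ≠ 0) (h4 : theta τ lam ≠ 0)
    (h5 : theta τ (-lam) ≠ 0) (h6 : theta τ (lam - tp + tq) ≠ 0)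
    (h7 : theta τ (tp - tq - lam) ≠ 0) (h8 : theta τ (tp - tq) ≠ 0) :
    (theta τ (u - tp) / theta τ (u - tq)) *
        deriv (fun w => fraks τ (w - tp) (lam - tp + tq)) u =
      (theta τ lam / theta τ (lam - tp + tq)) * (rho τ (tp - tq) - rho τ lam) *
          fraks τ (u - tq) lam -
        (theta' τ 0 / theta τ (tp - tq)) * fraks τ (u - tp) lam := by
  have hodd : theta τ (lam - tp + tq) = -theta τ (tp - tq - lam) := by
    rw [← theta_neg hτ]
    ring_nf
  have hneg : theta τ (-(lam - tp + tq)) = theta τ (tp - tq - lam) := by ring_nf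
  rw [deriv_fraks_sub_const hτ h1 (hneg ▸ h7), hneg, hodd, fraks, fraks, theta_neg hτ lam, rho, rho]
  have key := theta_three_term_deriv hτ (u - tp + (tp - tq - lam) / 2)
    (lam + (tp - tq - lam) / 2) ((tp - tq - lam) / 2)
  rw [show u - tp + (tp - tq - lam) / 2 + (tp - tq - lam) / 2 = u - lam - tq by ring,
    show u - tp + (tp - tq - lam) / 2 - (tp - tq - lam) / 2 = u - tp by ring,
    show lam + (tp - tq - lam) / 2 + (tp - tq - lam) / 2 = tp - tq by ring,
    show lam + (tp - tq - lam) / 2 - (tp - tq - lam) / 2 = lam by ring,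
    show u - tp + (tp - tq - lam) / 2 + (lam + (tp - tq - lam) / 2) = u - tq by ring,
    show u - tp + (tp - tq - lam) / 2 - (lam + (tp - tq - lam) / 2) = u - tp - lam by ring,
    add_halves] at key
  rw [show u - tp - (lam - tp + tq) = u - lam - tq by ring,
    show u - tq - lam = u - lam - tq by ring]
  field_simp
  linear_combination theta' τ 0 * key
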